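/- Let A, X ∈ ℂ^{n₁×n₁×n₃} be third-order tensors, ind(A) = k, and let A^D be the Drazin inverse of A. Then X is a GD inverse of A (i.e., A ⋆ X ⋆ A = A, X ⋆ A^{k+1} = A^k, and A^{k+1} ⋆ X = A^k) if and only if A ⋆ X ⋆ A = A and A^D ⋆ A² ⋆ X = A ⋆ A^D = X ⋆ A^D ⋆ A². -/

import Mathlib

open Matrix BigOperators

/-- A third-order complex tensor in `ℂ^{n₁ × n₂ × n₃}`, given by its frontal slices. -/
abbrev Tensor3 (n₁ n₂ n₃ : ℕ) := Fin n₃ → Matrix (Fin n₁) (Fin n₂) ℂ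

/-- Mode-3 product of a tensor with an `n₃ × n₃` matrix: the slices of the result are the
indicated linear combinations of the slices of `A`. -/
noncomputable def mode3 {n₁ n₂ n₃ : ℕ} (M : Matrix (Fin n₃) (Fin n₃) ℂ) (A : Tensor3 n₁ n₂ n₃) :
    Tensor3 n₁ n₂ n₃ :=
  fun i => ∑ j, M i j • A j

/-- The M-product `A ⋆_M B`: slice-wise matrix product in the transformed (hat) domain,
transformed back by `M⁻¹`. -/
noncomputable def mprod {n₁ n₂ l n₃ : ℕ} (M : Matrix (Fin n₃) (Fin n₃) ℂ)
    (A : Tensor3 n₁ n₂ n₃) (B : Tensor3 n₂ l n₃) : Tensor3 n₁ l n₃ :=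
  mode3 M⁻¹ (fun i => mode3 M A i * mode3 M B i)

/-- The identity tensor: every slice of its mode-3 transform is the identity matrix. -/
noncomputable def idT (n₁ : ℕ) {n₃ : ℕ} (M : Matrix (Fin n₃) (Fin n₃) ℂ) : Tensor3 n₁ n₁ n₃ :=
  mode3 M⁻¹ (fun _ => (1 : Matrix (Fin n₁) (Fin n₁) ℂ))

/-- Powers of a square tensor with respect to the M-product. -/
noncomputable def mpow {n₁ n₃ : ℕ} (M : Matrix (Fin n₃) (Fin n₃) ℂ) (A : Tensor3 n₁ n₁ n₃) :
    ℕ → Tensor3 n₁ n₁ n₃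
  | 0 => idT n₁ M
  | k + 1 => mprod M (mpow M A k) A

/-- Conjugate transpose with respect to the M-product: slice-wise conjugate transpose in the
transformed domain. -/
noncomputable def ctrans {n₁ n₂ n₃ : ℕ} (M : Matrix (Fin n₃) (Fin n₃) ℂ) (A : Tensor3 n₁ n₂ n₃) :
    Tensor3 n₂ n₁ n₃ :=
  mode3 M⁻¹ (fun i => (mode3 M A i)ᴴ)

/-- Index of a square complex matrix: the least `k ≥ 0` with `rank(B^k) = rank(B^{k+1})`. -/
noncomputable def matIndex {n : ℕ} (B : Matrix (Fin n) (Fin n) ℂ) : ℕ :=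
  sInf {k : ℕ | (B ^ k).rank = (B ^ (k + 1)).rank}

/-- Index of a tensor: the maximum of the indices of the slices of its mode-3 transform. -/
noncomputable def tIndex {n₁ n₃ : ℕ} (M : Matrix (Fin n₃) (Fin n₃) ℂ)
    (A : Tensor3 n₁ n₁ n₃) : ℕ :=
  Finset.univ.sup fun i => matIndex (mode3 M A i)

/-- `X` is a GD inverse of `A` with exponent `k`:
`A ⋆ X ⋆ A = A`, `X ⋆ A^{k+1} = A^k`, `A^{k+1} ⋆ X = A^k`. -/
def IsGD {n₁ n₃ : ℕ} (M : Matrix (Fin n₃) (Fin n₃) ℂ) (A X : Tensor3 n₁ n₁ n₃)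
    (k : ℕ) : Prop :=
  mprod M (mprod M A X) A = A ∧
  mprod M X (mpow M A (k + 1)) = mpow M A k ∧
  mprod M (mpow M A (k + 1)) X = mpow M A k

/-- `X` is the Drazin inverse of `A` with exponent `k`. -/
def IsDrazin {n₁ n₃ : ℕ} (M : Matrix (Fin n₃) (Fin n₃) ℂ) (A X : Tensor3 n₁ n₁ n₃)
    (k : ℕ) : Prop :=
  mprod M X (mpow M A (k + 1)) = mpow M A k ∧
  mprod M (mprod M X A) X = X ∧
  mprod M X A = mprod M A X

/-- `X` is the Moore–Penrose inverse of `A`. -/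
def IsMP {n₁ n₃ : ℕ} (M : Matrix (Fin n₃) (Fin n₃) ℂ) (A X : Tensor3 n₁ n₁ n₃) : Prop :=
  mprod M (mprod M A X) A = A ∧
  mprod M (mprod M X A) X = X ∧
  ctrans M (mprod M A X) = mprod M A X ∧
  ctrans M (mprod M X A) = mprod M X A

theorem mode3_mode3 {n₁ n₂ n₃ : ℕ} (M N : Matrix (Fin n₃) (Fin n₃) ℂ) (A : Tensor3 n₁ n₂ n₃) :
    mode3 M (mode3 N A) = mode3 (M * N) A := by
  funext i
  simp only [mode3, Finset.smul_sum, smul_smul, Matrix.mul_apply, Finset.sum_smul]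
  exact Finset.sum_comm

theorem mode3_one {n₁ n₂ n₃ : ℕ} (A : Tensor3 n₁ n₂ n₃) : mode3 1 A = A := by
  funext i
  simp [mode3, Matrix.one_apply, ite_smul]

theorem mode3_injective {n₁ n₂ n₃ : ℕ} {M : Matrix (Fin n₃) (Fin n₃) ℂ} (hM : IsUnit M) :
    Function.Injective (mode3 (n₁ := n₁) (n₂ := n₂) M) := by
  refine Function.LeftInverse.injective (g := mode3 M⁻¹) fun A => ?_
  rw [mode3_mode3, Matrix.nonsing_inv_mul M ((Matrix.isUnit_iff_isUnit_det M).mp hM), mode3_one]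

theorem mode3_mode3_inv {n₁ n₂ n₃ : ℕ} {M : Matrix (Fin n₃) (Fin n₃) ℂ} (hM : IsUnit M)
    (A : Tensor3 n₁ n₂ n₃) : mode3 M (mode3 M⁻¹ A) = A := by
  rw [mode3_mode3, Matrix.mul_nonsing_inv M ((Matrix.isUnit_iff_isUnit_det M).mp hM), mode3_one]

theorem mode3_mprod {n₁ n₃ : ℕ} {M : Matrix (Fin n₃) (Fin n₃) ℂ} (hM : IsUnit M)
    (A B : Tensor3 n₁ n₁ n₃) : mode3 M (mprod M A B) = mode3 M A * mode3 M B :=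
  mode3_mode3_inv hM _

theorem mprod_eq_iff {n₁ n₃ : ℕ} {M : Matrix (Fin n₃) (Fin n₃) ℂ} (hM : IsUnit M)
    (A B C : Tensor3 n₁ n₁ n₃) : mprod M A B = C ↔ mode3 M A * mode3 M B = mode3 M C := by
  rw [← (mode3_injective hM).eq_iff, mode3_mprod hM]

theorem mode3_mpow {n₁ n₃ : ℕ} {M : Matrix (Fin n₃) (Fin n₃) ℂ} (hM : IsUnit M)
    (A : Tensor3 n₁ n₁ n₃) (k : ℕ) : mode3 M (mpow M A k) = mode3 M A ^ k := by
  induction k with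
  | zero => exact mode3_mode3_inv hM _
  | succ k ih => rw [mpow, mode3_mprod hM, ih, pow_succ]

/-- If `d` is a Drazin inverse of `a`, then `x * a ^ (k + 1) = a ^ k` can be tested on the
core part of `a`. -/
theorem mul_pow_succ_eq_pow_iff_of_drazin {S : Type*} [Monoid S] {a d : S} {k : ℕ}
    (hpow : d * a ^ (k + 1) = a ^ k) (hd : d * a * d = d) (hc : Commute d a) (x : S) :
    x * a ^ (k + 1) = a ^ k ↔ a * d = x * d * a ^ 2 := by
  have hcore : x * d * a ^ 2 = x * a * (a * d) := by
    rw [mul_assoc, (hc.pow_right 2).eq, sq, mul_assoc, mul_assoc]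
  rw [hcore]
  constructor
  · intro h
    have hidem : IsIdempotentElem (a * d) := by
      rw [IsIdempotentElem, mul_assoc, ← mul_assoc d, hd]
    have had : a * d = a ^ (k + 1) * d ^ (k + 1) := by
      rw [← hc.symm.mul_pow, hidem.pow_succ_eq]
    calc a * d = a ^ (k + 1) * d ^ (k + 1) := had
      _ = x * a ^ (k + 1) * a * d ^ (k + 1) := by rw [h, pow_succ]
      _ = x * a * (a ^ (k + 1) * d ^ (k + 1)) := by
        rw [mul_assoc x, ← pow_succ, pow_succ' a (k + 1)]
        simp only [mul_assoc]
      _ = x * a * (a * d) := by rw [← had]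
  · intro h
    have hcore_pow : a * d * a ^ k = a ^ k := by
      rw [← hc.eq, mul_assoc, ← pow_succ', hpow]
    calc x * a ^ (k + 1) = x * a * (a * d * a ^ k) := by rw [hcore_pow, pow_succ', mul_assoc]
      _ = a * d * a ^ k := by rw [← mul_assoc (x * a), ← h]
      _ = a ^ k := hcore_pow

theorem pow_succ_mul_eq_pow_iff_of_drazin {S : Type*} [Monoid S] {a d : S} {k : ℕ}
    (hpow : d * a ^ (k + 1) = a ^ k) (hd : d * a * d = d) (hc : Commute d a) (x : S) :
    a ^ (k + 1) * x = a ^ k ↔ d * a ^ 2 * x = a * d := by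
  have h := mul_pow_succ_eq_pow_iff_of_drazin (a := MulOpposite.op a) (d := MulOpposite.op d)
    (k := k)
    (by rw [← MulOpposite.op_pow, ← MulOpposite.op_pow, ← MulOpposite.op_mul,
      ← (hc.pow_right (k + 1)).eq, hpow])
    (by rw [← MulOpposite.op_mul, ← MulOpposite.op_mul, ← mul_assoc, hd])
    hc.op (MulOpposite.op x)
  simp only [← MulOpposite.op_pow, ← MulOpposite.op_mul, MulOpposite.op_inj] at h
  rw [h, ← mul_assoc, (hc.pow_right 2).eq, hc.eq, eq_comm]

/-- with `A^D` the Drazin inverse of `A` and `k = ind(A)`, `X` is a GD inverse of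
`A` iff `A ⋆ X ⋆ A = A` and `A^D ⋆ A² ⋆ X = A ⋆ A^D = X ⋆ A^D ⋆ A²`. -/
theorem gd_iff_drazin_square_commutation {n₁ n₃ : ℕ} (hn₁ : 0 < n₁) (hn₃ : 0 < n₃)
    (M : Matrix (Fin n₃) (Fin n₃) ℂ) (hM : IsUnit M)
    (A X AD : Tensor3 n₁ n₁ n₃) (k : ℕ) (hk : tIndex M A = k)
    (hAD : IsDrazin M A AD k) :
    IsGD M A X k ↔
      (mprod M (mprod M A X) A = A ∧
        mprod M (mprod M AD (mpow M A 2)) X = mprod M A AD ∧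
        mprod M A AD = mprod M (mprod M X AD) (mpow M A 2)) := by
  rw [IsDrazin] at hAD
  rw [IsGD]
  simp only [mprod_eq_iff hM, mode3_mprod hM, mode3_mpow hM] at hAD ⊢
  obtain ⟨hpow, hd, hc⟩ := hAD
  rw [mul_pow_succ_eq_pow_iff_of_drazin hpow hd hc,
    pow_succ_mul_eq_pow_iff_of_drazin hpow hd hc]
  tauto
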